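/- Let H be a finite-dimensional quasitriangular Hopf algebra. The antipode of the braided dual L₀,₁(H) is a braided anti-homomorphism: for all φ, ψ ∈ H*, S_L(φ·ψ) = S_L(coad(R₍₁₎)(ψ)) · S_L(coad(R₍₂₎)(φ)) (implicit summation over R, all products being the product of L₀,₁(H)), where S_L(φ) is the linear form h ↦ φ(R₍₂₎ u⁻¹ S(h) S(R₍₁₎)). -/

import Mathlib

/-!
Statement 19: Let `H` be a finite-dimensional quasitriangular Hopf algebra.  The antipode
`S_L` of the braided dual `L₀,₁(H)` is a braided anti-homomorphism: for all `φ, ψ ∈ H*`,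
`S_L(φ·ψ) = S_L(coad(R₍₁₎)(ψ)) · S_L(coad(R₍₂₎)(φ))` (implicit summation over `R`, all
products being the product of `L₀,₁(H)`).
-/

open TensorProduct MulOpposite

noncomputable section

/-- An element `R = ∑ i, a i ⊗ b i` of `H ⊗ H` presented by finite families of components
(`a i` are the `R₍₁₎`-components, `b i` the `R₍₂₎`-components, with implicit summation). -/
structure RMat (k H : Type*) [CommSemiring k] [AddCommMonoid H] [Module k H] where
  m : ℕ
  a : Fin m → H
  b : Fin m → H

/-- A quasitriangular structure on the Hopf algebra `H`: the antipode is bijective (with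
explicit inverse `Sinv`), and `R = ∑ i, a i ⊗ b i` is an invertible element of `H ⊗ H`
satisfying quasi-cocommutativity `R·Δ(h) = Δᵒᵖ(h)·R` and the quasitriangularity axioms
`(Δ ⊗ id)(R) = R₁₃·R₂₃` and `(id ⊗ Δ)(R) = R₁₃·R₁₂` (in `H ⊗ (H ⊗ H)`). -/
structure QT (k H : Type*) [Field k] [Ring H] [HopfAlgebra k H] extends RMat k H where
  Sinv : H →ₗ[k] H
  Sinv_antipode : ∀ h : H, Sinv (HopfAlgebra.antipode (R := k) h) = h
  antipode_Sinv : ∀ h : H, HopfAlgebra.antipode (R := k) (Sinv h) = h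
  isUnit_el : IsUnit (∑ i, a i ⊗ₜ[k] b i : H ⊗[k] H)
  qcc : ∀ h : H,
    (∑ i, a i ⊗ₜ[k] b i : H ⊗[k] H) * Coalgebra.comul (R := k) h =
      (TensorProduct.comm k H H) (Coalgebra.comul (R := k) h) * ∑ i, a i ⊗ₜ[k] b i
  qt_rTensor : (TensorProduct.assoc k H H H)
      (TensorProduct.map (Coalgebra.comul (R := k) (A := H)) LinearMap.id
        (∑ i, a i ⊗ₜ[k] b i)) =
    (∑ i, a i ⊗ₜ[k] ((1 : H) ⊗ₜ[k] b i)) * ∑ i, (1 : H) ⊗ₜ[k] (a i ⊗ₜ[k] b i)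
  qt_lTensor : TensorProduct.map LinearMap.id (Coalgebra.comul (R := k) (A := H))
      (∑ i, a i ⊗ₜ[k] b i) =
    (∑ i, a i ⊗ₜ[k] ((1 : H) ⊗ₜ[k] b i)) * ∑ i, a i ⊗ₜ[k] (b i ⊗ₜ[k] (1 : H))

variable {k H : Type*} [Field k] [Ring H] [HopfAlgebra k H]

/-- The map `Φ₀,₁ : H* → H`, `φ ↦ (φ ⊗ id)(R·R₂₁) = φ(R¹₍₁₎ R²₍₂₎) R¹₍₂₎ R²₍₁₎`. -/
def RMat.phi (Q : RMat k H) (φ : Module.Dual k H) : H :=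
  ∑ i, ∑ j, φ (Q.a i * Q.b j) • (Q.b i * Q.a j)

/-- The convolution product on `H*`: `(φ ⋆ ψ)(h) = φ(h₍₁₎)ψ(h₍₂₎)`. -/
def conv (φ ψ : Module.Dual k H) : Module.Dual k H :=
  TensorProduct.lift ((LinearMap.mul k k).compl₁₂ φ ψ) ∘ₗ
    (Coalgebra.comul (R := k) (A := H))

/-- The product of `L₀,₁(H)` on `H*`:
`(φ·ψ)(h) = φ(h₍₁₎ R²₍₂₎ S(R¹₍₂₎)) ψ(R¹₍₁₎ h₍₂₎ R²₍₁₎)` (`R¹` indexed by `i`, `R²` by `j`). -/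
def RMat.lmul (Q : RMat k H) (φ ψ : Module.Dual k H) : Module.Dual k H :=
  ∑ i, ∑ j,
    conv (φ ∘ₗ LinearMap.mulRight k (Q.b j * HopfAlgebra.antipode (R := k) (Q.b i)))
      (ψ ∘ₗ LinearMap.mulLeft k (Q.a i) ∘ₗ LinearMap.mulRight k (Q.a j))

/-- The bilinear map `(h₁, h₂) ↦ (x ↦ h₁ * x * S(h₂))`. -/
def conjBil (k H : Type*) [Field k] [Ring H] [HopfAlgebra k H] :
    H →ₗ[k] H →ₗ[k] (H →ₗ[k] H) :=
  ((LinearMap.llcomp k H H H).comp (LinearMap.mul k H)).compl₂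
    ((LinearMap.mul k H).flip ∘ₗ HopfAlgebra.antipode (R := k))

/-- The right coadjoint action of `H` on `H*`: `coad(h)(φ) = φ(h₍₁₎ ? S(h₍₂₎))`. -/
def coad (h : H) (φ : Module.Dual k H) : Module.Dual k H :=
  φ ∘ₗ TensorProduct.lift (conjBil k H) (Coalgebra.comul (R := k) h)

/-- The inverse `u⁻¹ = S⁻²(R₍₂₎)R₍₁₎` of the Drinfeld element `u = S(R₍₂₎)R₍₁₎`. -/
def QT.uinv (Q : QT k H) : H := ∑ i, Q.Sinv (Q.Sinv (Q.b i)) * Q.a i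

/-- The antipode `S_L` of the braided dual `L₀,₁(H)`:
`S_L(φ)(h) = φ(R₍₂₎ u⁻¹ S(h) S(R₍₁₎))`. -/
def QT.sL (Q : QT k H) (φ : Module.Dual k H) : Module.Dual k H :=
  ∑ i, φ ∘ₗ (LinearMap.mulLeft k (Q.b i * Q.uinv) ∘ₗ
    LinearMap.mulRight k (HopfAlgebra.antipode (R := k) (Q.a i)) ∘ₗ
      HopfAlgebra.antipode (R := k))

section Auxiliary

open HopfAlgebra Coalgebra Finset WithConv

/-- The antipode is an anti-homomorphism of coalgebras. -/
theorem comul_antipode (h : H) :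
    comul (R := k) (antipode k h) =
      TensorProduct.map (antipode k) (antipode k)
        (TensorProduct.comm k H H (comul (R := k) h)) := by
  let ι₁ : H →ₐ[k] H ⊗[k] H := Algebra.TensorProduct.includeLeft
  let ι₂ : H →ₐ[k] H ⊗[k] H := Algebra.TensorProduct.includeRight
  have cancel (f : H →ₐ[k] H ⊗[k] H) :
      toConv (f.toLinearMap ∘ₗ antipode k) * toConv f.toLinearMap = 1 := by
    have := LinearMap.algHom_comp_convMul_distrib (R := k) f
      (toConv (antipode k (A := H))) (toConv LinearMap.id)
    rw [LinearMap.antipode_mul_id] at this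
    apply WithConv.ofConv_injective
    simp only [LinearMap.comp_id] at this
    rw [← this]
    ext x
    simp [LinearMap.convOne_def]
  have hδ : toConv (comul (R := k) (A := H)) =
      toConv ι₁.toLinearMap * toConv ι₂.toLinearMap := by
    ext x
    rw [(ℛ k x).convMul_apply]
    conv_lhs => simp only [WithConv.ofConv_toConv, ← (ℛ k x).eq]
    simp [ι₁, ι₂]
  have hG : toConv (TensorProduct.map (antipode k) (antipode k) ∘ₗ
      (TensorProduct.comm k H H).toLinearMap ∘ₗ comul (R := k) (A := H)) =
      toConv (ι₂.toLinearMap ∘ₗ antipode k) * toConv (ι₁.toLinearMap ∘ₗ antipode k) := by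
    ext x
    rw [(ℛ k x).convMul_apply]
    conv_lhs =>
      simp only [WithConv.ofConv_toConv, LinearMap.comp_apply, ← (ℛ k x).eq]
    simp [ι₁, ι₂]
  have hinv : toConv (TensorProduct.map (antipode k) (antipode k) ∘ₗ
      (TensorProduct.comm k H H).toLinearMap ∘ₗ comul (R := k) (A := H)) *
      toConv (comul (R := k) (A := H)) = 1 := by
    rw [hG, hδ, mul_assoc, ← mul_assoc (toConv (ι₁.toLinearMap ∘ₗ antipode k)), cancel, one_mul,
      cancel]
  have := left_inv_eq_right_inv hinv (LinearMap.comul_right_inv (R := k) (C := H))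
  exact (LinearMap.congr_fun (congrArg WithConv.ofConv this) h).symm

theorem comul_antipode_antipode (h : H) :
    comul (R := k) (antipode k (antipode k h)) =
      TensorProduct.map (antipode k ∘ₗ antipode k) (antipode k ∘ₗ antipode k)
        (comul (R := k) h) := by
  rw [comul_antipode, comul_antipode, ← (ℛ k h).eq]
  simp

namespace RMat

/-- The tensor `∑ i, a i ⊗ b i`. -/
def el (Q : RMat k H) : H ⊗[k] H := ∑ i, Q.a i ⊗ₜ[k] Q.b i

/-- The flipped tensor `∑ i, b i ⊗ a i`. -/
def elOp (Q : RMat k H) : H ⊗[k] H := ∑ i, Q.b i ⊗ₜ[k] Q.a i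

end RMat

namespace QT

variable {V : Type*} [AddCommMonoid V] [Module k V]

theorem sum_comul_left (Q : QT k H) (β : H ⊗[k] H →ₗ[k] H →ₗ[k] V) :
    ∑ i, β (comul (R := k) (Q.a i)) (Q.b i) =
      ∑ i, ∑ j, β (Q.a i ⊗ₜ Q.a j) (Q.b i * Q.b j) := by
  have := congrArg (TensorProduct.lift β ∘ₗ (TensorProduct.assoc k H H H).symm.toLinearMap)
    Q.qt_rTensor
  simpa [sum_mul_sum] using this

theorem sum_comul_right (Q : QT k H) (β : H →ₗ[k] H ⊗[k] H →ₗ[k] V) :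
    ∑ i, β (Q.a i) (comul (R := k) (Q.b i)) =
      ∑ i, ∑ j, β (Q.a i * Q.a j) (Q.b j ⊗ₜ Q.b i) := by
  have := congrArg (TensorProduct.lift β) Q.qt_lTensor
  simpa [sum_mul_sum] using this

/-- `(Δ ⊗ Δ)(R) = R₁₄ R₁₃ R₂₄ R₂₃`, evaluated on a bilinear map. -/
theorem sum_comul_comul (Q : QT k H) (β : H ⊗[k] H →ₗ[k] H ⊗[k] H →ₗ[k] V) :
    ∑ i, β (comul (R := k) (Q.a i)) (comul (R := k) (Q.b i)) =
      ∑ p, ∑ q, ∑ r, ∑ s, β ((Q.a p * Q.a q) ⊗ₜ (Q.a r * Q.a s))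
        ((Q.b q * Q.b s) ⊗ₜ (Q.b p * Q.b r)) := by
  have h₁ := Q.sum_comul_left (β.compl₂ (comul (R := k)))
  simp only [LinearMap.compl₂_apply, Bialgebra.comul_mul] at h₁
  rw [h₁, sum_comm]
  have h₂ (j) := Q.sum_comul_right (V := V) (LinearMap.mk₂ k
    (fun x Y => β (x ⊗ₜ Q.a j) (Y * comul (R := k) (Q.b j)))
    (by intros; simp [add_tmul]) (by intros; simp [← smul_tmul'])
    (by intros; simp [add_mul]) (by intros; simp))
  simp only [LinearMap.mk₂_apply] at h₂
  simp only [h₂]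
  rw [sum_comm]
  refine sum_congr rfl fun p _ => ?_
  rw [sum_comm]
  refine sum_congr rfl fun q _ => ?_
  have h₃ := Q.sum_comul_right (V := V) (LinearMap.mk₂ k
    (fun x Y => β ((Q.a p * Q.a q) ⊗ₜ x) ((Q.b q ⊗ₜ Q.b p) * Y))
    (by intros; simp [tmul_add]) (by intros; simp)
    (by intros; simp [mul_add]) (by intros; simp))
  simpa using h₃

theorem el_mul_comul (Q : QT k H) (h : H) :
    Q.el * comul (R := k) h = TensorProduct.comm k H H (comul (R := k) h) * Q.el :=
  Q.qcc h

theorem comm_el (Q : QT k H) : TensorProduct.comm k H H Q.el = Q.elOp := by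
  simp [RMat.el, RMat.elOp]

theorem elOp_mul_comm_comul (Q : QT k H) (h : H) :
    Q.elOp * TensorProduct.comm k H H (comul (R := k) h) = comul (R := k) h * Q.elOp := by
  have := congrArg (Algebra.TensorProduct.comm k H H) (Q.el_mul_comul h)
  rw [map_mul, map_mul] at this
  have e (t : H ⊗[k] H) : Algebra.TensorProduct.comm k H H t = TensorProduct.comm k H H t := rfl
  simpa only [e, comm_el, TensorProduct.comm_comm] using this

theorem sum_counit_left_smul (Q : QT k H) : ∑ i, counit (R := k) (Q.a i) • Q.b i = 1 := by
  have h := Q.sum_comul_left (TensorProduct.AlgebraTensorModule.mk k k H H ∘ₗ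
    TensorProduct.lift (LinearMap.lsmul k H ∘ₗ counit (R := k)))
  have e (x : H) : TensorProduct.lift (LinearMap.lsmul k H ∘ₗ counit (R := k))
      (comul (R := k) x) = x :=
    LinearMap.congr_fun (lift_lsmul_comp_counit_comp_comul (R := k) (A := H)) x
  have h' : Q.el = ((1 : H) ⊗ₜ (∑ i, counit (R := k) (Q.a i) • Q.b i)) * Q.el := by
    simp only [LinearMap.comp_apply, e] at h
    simp only [RMat.el, tmul_sum, sum_mul_sum]
    simpa [smul_tmul'] using h
  have h1 : (1 : H) ⊗ₜ[k] (∑ i, counit (R := k) (Q.a i) • Q.b i) = 1 :=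
    Q.isUnit_el.mul_right_cancel (by rw [one_mul]; exact h'.symm)
  simpa [Algebra.TensorProduct.one_def] using congrArg (LinearMap.mul' k H) h1

theorem sum_counit_right_smul (Q : QT k H) : ∑ i, counit (R := k) (Q.b i) • Q.a i = 1 := by
  have h := Q.sum_comul_right ((TensorProduct.AlgebraTensorModule.mk k k H H).compl₂
    (TensorProduct.lift (LinearMap.lsmul k H ∘ₗ counit (R := k))))
  have e (x : H) : TensorProduct.lift (LinearMap.lsmul k H ∘ₗ counit (R := k))
      (comul (R := k) x) = x :=
    LinearMap.congr_fun (lift_lsmul_comp_counit_comp_comul (R := k) (A := H)) x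
  have h' : Q.el = Q.el * ((∑ i, counit (R := k) (Q.b i) • Q.a i) ⊗ₜ (1 : H)) := by
    simp only [LinearMap.compl₂_apply, e] at h
    simp only [RMat.el, sum_tmul, sum_mul_sum]
    simpa [smul_tmul'] using h
  have h1 : (∑ i, counit (R := k) (Q.b i) • Q.a i) ⊗ₜ[k] (1 : H) = 1 :=
    Q.isUnit_el.mul_left_cancel (by rw [mul_one]; exact h'.symm)
  simpa [Algebra.TensorProduct.one_def] using congrArg (LinearMap.mul' k H) h1

theorem antipode_el_mul_el (Q : QT k H) :
    (∑ i, antipode k (Q.a i) ⊗ₜ[k] Q.b i) * Q.el = 1 := by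
  have h := Q.sum_comul_left (TensorProduct.AlgebraTensorModule.mk k k H H ∘ₗ
    LinearMap.mul' k H ∘ₗ (antipode k).rTensor H)
  simp only [LinearMap.comp_apply, mul_antipode_rTensor_comul_apply] at h
  rw [RMat.el, sum_mul_sum]
  simp only [Algebra.TensorProduct.tmul_mul_tmul]
  refine Eq.trans ?_ (h.symm.trans ?_)
  · simp
  · have := congrArg (fun c => (1 : H) ⊗ₜ[k] c) Q.sum_counit_left_smul
    simpa [Algebra.algebraMap_eq_smul_one, tmul_sum, Algebra.TensorProduct.one_def,
      ← smul_tmul'] using this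

theorem map_antipode_antipode_el (Q : QT k H) :
    ∑ i, antipode k (Q.a i) ⊗ₜ[k] antipode k (Q.b i) = Q.el := by
  refine left_inv_eq_right_inv (a := ∑ i, antipode k (Q.a i) ⊗ₜ[k] Q.b i) ?_
    Q.antipode_el_mul_el
  have h := Q.sum_comul_right ((TensorProduct.AlgebraTensorModule.mk k k H H ∘ₗ
    antipode k).compl₂ (LinearMap.mul' k H ∘ₗ (antipode k).rTensor H))
  simp only [LinearMap.comp_apply, LinearMap.compl₂_apply, mul_antipode_rTensor_comul_apply] at h
  rw [sum_mul_sum, sum_comm]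
  simp only [Algebra.TensorProduct.tmul_mul_tmul]
  refine Eq.trans ?_ (h.symm.trans ?_)
  · simp [antipode_mul_antidistrib]
  · have := congrArg (fun c => antipode k c ⊗ₜ[k] (1 : H)) Q.sum_counit_right_smul
    simpa [Algebra.algebraMap_eq_smul_one, sum_tmul, Algebra.TensorProduct.one_def,
      ← smul_tmul'] using this

theorem sum_antipode_tmul_antipode_op (Q : QT k H) :
    ∑ i, antipode k (Q.b i) ⊗ₜ[k] antipode k (Q.a i) = Q.elOp := by
  simpa [comm_el] using congrArg (TensorProduct.comm k H H) Q.map_antipode_antipode_el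

theorem map_antipode_sq_el (Q : QT k H) :
    ∑ i, antipode k (antipode k (Q.a i)) ⊗ₜ[k] antipode k (antipode k (Q.b i)) = Q.el := by
  have h := congrArg (TensorProduct.map (antipode k) (antipode k)) Q.map_antipode_antipode_el
  rw [← Q.map_antipode_antipode_el]
  simpa [RMat.el] using h

/-- The inverse `∑ i, b i ⊗ S (a i)` of the flipped R-matrix. -/
def elOpInv (Q : QT k H) : H ⊗[k] H := ∑ i, Q.b i ⊗ₜ[k] antipode k (Q.a i)

theorem elOp_mul_elOpInv (Q : QT k H) : Q.elOp * Q.elOpInv = 1 := by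
  have h : Q.el * (∑ i, antipode k (Q.a i) ⊗ₜ[k] Q.b i) = 1 := by
    refine Q.isUnit_el.mul_right_cancel (?_ : _ * Q.el = _ * Q.el)
    rw [mul_assoc, antipode_el_mul_el, mul_one, one_mul]
  have := congrArg (Algebra.TensorProduct.comm k H H) h
  rw [map_mul, map_one] at this
  simpa [RMat.el, RMat.elOp, elOpInv] using this

theorem sum_mul_elOpInv_mul (Q : QT k H) :
    ∑ i, (Q.b i ⊗ₜ[k] (1 : H)) * Q.elOpInv * ((1 : H) ⊗ₜ[k] antipode k (antipode k (Q.a i))) =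
      1 := by
  have h := congrArg (TensorProduct.map LinearMap.id (antipode k) ∘ₗ
    (TensorProduct.comm k H H).toLinearMap) Q.antipode_el_mul_el
  rw [RMat.el, sum_mul_sum] at h
  simpa [elOpInv, mul_sum, sum_mul, antipode_mul_antidistrib, Algebra.TensorProduct.one_def]
    using h

theorem uinv_eq (Q : QT k H) : Q.uinv = ∑ i, Q.b i * antipode k (antipode k (Q.a i)) := by
  have h := congrArg (LinearMap.mul' k H ∘ₗ TensorProduct.map (Q.Sinv ∘ₗ Q.Sinv) LinearMap.id ∘ₗ
    (TensorProduct.comm k H H).toLinearMap) Q.map_antipode_sq_el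
  simpa [RMat.el, uinv, Q.Sinv_antipode] using h.symm

theorem _root_.sum_comul_mul_one_tmul_antipode (y : H) :
    ∑ j ∈ (ℛ k y).index, comul (R := k) ((ℛ k y).left j) *
      ((1 : H) ⊗ₜ[k] antipode k ((ℛ k y).right j)) = y ⊗ₜ[k] 1 := by
  have h := congrArg (TensorProduct.map LinearMap.id
    (LinearMap.mul' k H ∘ₗ (antipode k).lTensor H)) (coassoc_apply (R := k) y)
  have e (t : H ⊗[k] H) (w : H) : TensorProduct.map LinearMap.id
      (LinearMap.mul' k H ∘ₗ (antipode k).lTensor H) (TensorProduct.assoc k H H H (t ⊗ₜ w)) =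
      t * ((1 : H) ⊗ₜ[k] antipode k w) := by
    induction t with
    | zero => simp
    | tmul x y => simp
    | add x y hx hy => simp only [add_tmul, map_add, add_mul, hx, hy]
  conv at h => rw [← (ℛ k y).eq]
  simp only [map_sum, LinearMap.rTensor_tmul, LinearMap.lTensor_tmul, e] at h
  rw [h]
  simp only [TensorProduct.map_tmul, LinearMap.comp_apply, mul_antipode_lTensor_comul_apply,
    LinearMap.id_apply]
  simpa only [map_sum, TensorProduct.map_tmul, LinearMap.id_apply, Algebra.linearMap_apply,
    map_one] using congrArg (TensorProduct.map LinearMap.id (Algebra.linearMap k H))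
      (sum_tmul_counit_eq (ℛ k y))

theorem uinv_mul_antipode_antipode (Q : QT k H) (y : H) :
    Q.uinv * antipode k (antipode k y) = y * Q.uinv := by
  let Θ : H ⊗[k] H →ₗ[k] H := LinearMap.mul' k H ∘ₗ
    TensorProduct.map LinearMap.id (antipode k ∘ₗ antipode k) ∘ₗ
      (TensorProduct.comm k H H).toLinearMap
  let Λ (i : Fin Q.m) : H ⊗[k] (H ⊗[k] H) →ₗ[k] H := LinearMap.mul' k H ∘ₗ
    TensorProduct.map (LinearMap.mulRight k (Q.b i))
      (LinearMap.mulRight k (antipode k (antipode k (Q.a i))) ∘ₗ antipode k ∘ₗ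
        LinearMap.mul' k H ∘ₗ (antipode k).rTensor H)
  have hΘ (t : H ⊗[k] H) (w : H) : Θ (TensorProduct.comm k H H t * Q.el *
      ((1 : H) ⊗ₜ[k] antipode k w)) = ∑ i, Λ i (TensorProduct.assoc k H H H (t ⊗ₜ w)) := by
    induction t with
    | zero => simp
    | tmul x y =>
      simp [Θ, Λ, RMat.el, mul_sum, sum_mul, antipode_mul_antidistrib, mul_assoc]
    | add x y hx hy => simp only [add_tmul, map_add, add_mul, sum_add_distrib, hx, hy]
  have hΛ (i) : ∑ j ∈ (ℛ k y).index, Λ i (TensorProduct.assoc k H H H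
      (comul (R := k) ((ℛ k y).left j) ⊗ₜ (ℛ k y).right j)) =
      y * (Q.b i * antipode k (antipode k (Q.a i))) := by
    have h := congrArg (Λ i) (coassoc_apply (R := k) y)
    conv at h => rw [← (ℛ k y).eq]
    simp only [map_sum, LinearMap.rTensor_tmul, LinearMap.lTensor_tmul] at h
    rw [h]
    simp only [Λ, LinearMap.comp_apply, TensorProduct.map_tmul, mul_antipode_rTensor_comul_apply]
    have := congrArg (LinearMap.mul' k H ∘ₗ TensorProduct.map LinearMap.id
      (Algebra.linearMap k H)) (sum_tmul_counit_eq (ℛ k y))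
    simp only [map_sum, LinearMap.comp_apply, TensorProduct.map_tmul, LinearMap.id_apply,
      LinearMap.mul'_apply, Algebra.linearMap_apply, map_one, mul_one,
      Algebra.algebraMap_eq_smul_one, mul_smul_comm] at this
    simp only [LinearMap.mul'_apply, LinearMap.mulRight_apply, Algebra.algebraMap_eq_smul_one,
      map_smul, antipode_one, one_mul, mul_smul_comm]
    conv_rhs => rw [← this]
    simp [sum_mul, mul_assoc]
  have h₁ : Θ (Q.el * (y ⊗ₜ[k] (1 : H))) = Q.uinv * antipode k (antipode k y) := by
    simp [Θ, RMat.el, sum_mul, uinv_eq, antipode_mul_antidistrib, mul_assoc]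
  rw [← h₁, ← sum_comul_mul_one_tmul_antipode, mul_sum, map_sum]
  simp only [← mul_assoc, el_mul_comul, hΘ]
  rw [sum_comm]
  simp only [hΛ, uinv_eq, mul_sum]

theorem sum_comm_comul_mul_elOpInv_mul (Q : QT k H) :
    ∑ i, TensorProduct.comm k H H (comul (R := k) (Q.b i)) * Q.elOpInv *
      comul (R := k) (antipode k (antipode k (Q.a i))) = Q.el * (Q.uinv ⊗ₜ[k] Q.uinv) := by
  have h := Q.sum_comul_comul (LinearMap.mk₂ k
    (fun X Y => TensorProduct.comm k H H Y * Q.elOpInv *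
      TensorProduct.map (antipode k ∘ₗ antipode k) (antipode k ∘ₗ antipode k) X)
    (by intros; simp [mul_add]) (by intros; simp)
    (by intros; simp [add_mul]) (by intros; simp))
  simp only [LinearMap.mk₂_apply, ← comul_antipode_antipode] at h
  rw [h]
  have e (p q r s : Fin Q.m) :
      TensorProduct.comm k H H ((Q.b q * Q.b s) ⊗ₜ[k] (Q.b p * Q.b r)) * Q.elOpInv *
        TensorProduct.map (antipode k ∘ₗ antipode k) (antipode k ∘ₗ antipode k)
          ((Q.a p * Q.a q) ⊗ₜ[k] (Q.a r * Q.a s)) =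
      (Q.b p ⊗ₜ[k] (Q.b q * Q.b s)) *
        ((Q.b r ⊗ₜ[k] (1 : H)) * Q.elOpInv *
          ((1 : H) ⊗ₜ[k] antipode k (antipode k (Q.a r)))) *
        ((antipode k (antipode k (Q.a p)) * antipode k (antipode k (Q.a q))) ⊗ₜ[k]
          antipode k (antipode k (Q.a s))) := by
    simp [elOpInv, mul_sum, sum_mul, antipode_mul_antidistrib, mul_assoc]
  have e' (p q : Fin Q.m) : ∑ r, ∑ s,
      TensorProduct.comm k H H ((Q.b q * Q.b s) ⊗ₜ[k] (Q.b p * Q.b r)) * Q.elOpInv *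
        TensorProduct.map (antipode k ∘ₗ antipode k) (antipode k ∘ₗ antipode k)
          ((Q.a p * Q.a q) ⊗ₜ[k] (Q.a r * Q.a s)) =
      (Q.b p * antipode k (antipode k (Q.a p)) * antipode k (antipode k (Q.a q))) ⊗ₜ[k]
        (Q.b q * Q.uinv) := by
    rw [sum_comm]
    simp only [e, ← sum_mul, ← mul_sum, sum_mul_elOpInv_mul]
    simp [uinv_eq, mul_sum, tmul_sum, mul_assoc]
  simp only [e']
  rw [sum_comm]
  simp only [← sum_tmul, ← sum_mul, ← uinv_eq, uinv_mul_antipode_antipode]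
  simp [RMat.el, sum_mul]

theorem comul_uinv (Q : QT k H) :
    comul (R := k) Q.uinv = Q.elOp * Q.el * (Q.uinv ⊗ₜ[k] Q.uinv) := by
  rw [mul_assoc, ← sum_comm_comul_mul_elOpInv_mul, mul_sum]
  simp only [← mul_assoc, elOp_mul_comm_comul]
  conv_lhs => rw [uinv_eq]
  simp only [map_sum, Bialgebra.comul_mul]
  refine sum_congr rfl fun i _ => ?_
  rw [mul_assoc (comul (R := k) (Q.b i)), elOp_mul_elOpInv, mul_one]

/-- The predual map `y ↦ R₍₂₎ u⁻¹ S(y) S(R₍₁₎)` of `S_L`. -/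
def braidedAntipode (Q : QT k H) : H →ₗ[k] H :=
  ∑ i, LinearMap.mulLeft k (Q.b i * Q.uinv) ∘ₗ
    LinearMap.mulRight k (antipode k (Q.a i)) ∘ₗ antipode k

theorem braidedAntipode_apply (Q : QT k H) (y : H) :
    Q.braidedAntipode y = ∑ i, Q.b i * Q.uinv * antipode k (Q.a i * y) := by
  simp [braidedAntipode, antipode_mul_antidistrib, mul_assoc]

theorem sL_apply (Q : QT k H) (φ : Module.Dual k H) (y : H) :
    Q.sL φ y = φ (Q.braidedAntipode y) := by
  simp [sL, braidedAntipode]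

/-- The flipped braided coproduct of `h`, with `Δ h` replaced by `x ⊗ y`, mapped through the
braided antipode in both legs. -/
theorem sum_braidedAntipode_tmul (Q : QT k H) (x y : H) :
    ∑ i, ∑ j, Q.braidedAntipode (Q.a i * y * Q.a j) ⊗ₜ[k]
        Q.braidedAntipode (x * (Q.b j * antipode k (Q.b i))) =
      ∑ q, ∑ r, ∑ s, (Q.b r ⊗ₜ[k] (Q.b q * Q.b s)) * (Q.el * (Q.uinv ⊗ₜ[k] Q.uinv)) *
        (antipode k (Q.a r * Q.a s * y) ⊗ₜ[k] antipode k (Q.a q * x)) := by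
  have h (i : Fin Q.m) := congrArg (TensorProduct.map
    (Q.braidedAntipode ∘ₗ LinearMap.mulLeft k (Q.a i * y))
    (Q.braidedAntipode ∘ₗ LinearMap.mulLeft k x ∘ₗ
      LinearMap.mulRight k (antipode k (Q.b i)))) Q.map_antipode_antipode_el
  simp only [RMat.el, map_sum, TensorProduct.map_tmul, LinearMap.comp_apply,
    LinearMap.mulLeft_apply, LinearMap.mulRight_apply] at h
  simp only [← h]
  have e₁ (v w z : H) : v * Q.uinv * antipode k (w * antipode k z) =
      v * z * Q.uinv * antipode k w := by
    simp only [antipode_mul_antidistrib, mul_assoc]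
    rw [← mul_assoc z, ← Q.uinv_mul_antipode_antipode z, mul_assoc]
  simp only [braidedAntipode_apply, ← mul_assoc, e₁]
  simp only [RMat.el, sum_tmul, tmul_sum, sum_mul, mul_sum,
    Algebra.TensorProduct.tmul_mul_tmul]
  exact (sum_congr rfl fun _ _ => sum_comm).trans (sum_comm.trans (sum_congr rfl fun _ _ =>
    (sum_congr rfl fun _ _ => sum_comm).trans sum_comm))

/-- The operator `t ↦ (R₍₂₎ ⊗ 1) t (1 ⊗ S(R₍₁₎))`. -/
def outerTwist (Q : QT k H) : H ⊗[k] H →ₗ[k] H ⊗[k] H :=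
  ∑ i, LinearMap.mulLeft k (Q.b i ⊗ₜ[k] (1 : H)) ∘ₗ
    LinearMap.mulRight k ((1 : H) ⊗ₜ[k] antipode k (Q.a i))

/-- The operator `t ↦ (1 ⊗ R₍₁₎) t (S(R₍₂₎) ⊗ 1)`. -/
def innerTwist (Q : QT k H) : H ⊗[k] H →ₗ[k] H ⊗[k] H :=
  ∑ i, LinearMap.mulLeft k ((1 : H) ⊗ₜ[k] Q.a i) ∘ₗ
    LinearMap.mulRight k (antipode k (Q.b i) ⊗ₜ[k] (1 : H))

theorem outerTwist_apply (Q : QT k H) (t : H ⊗[k] H) :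
    Q.outerTwist t = ∑ i, (Q.b i ⊗ₜ[k] (1 : H)) * t * ((1 : H) ⊗ₜ[k] antipode k (Q.a i)) := by
  simp [outerTwist, mul_assoc]

theorem innerTwist_apply (Q : QT k H) (t : H ⊗[k] H) :
    Q.innerTwist t = ∑ i, ((1 : H) ⊗ₜ[k] Q.a i) * t * (antipode k (Q.b i) ⊗ₜ[k] (1 : H)) := by
  simp [innerTwist, mul_assoc]

theorem outerTwist_sum_braidedAntipode_tmul (Q : QT k H) (x y : H) :
    Q.outerTwist (∑ i, ∑ j, Q.braidedAntipode (Q.a i * y * Q.a j) ⊗ₜ[k]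
        Q.braidedAntipode (x * (Q.b j * antipode k (Q.b i)))) =
      ∑ i, TensorProduct.comm k H H (comul (R := k) (Q.b i)) *
        (Q.el * (Q.uinv ⊗ₜ[k] Q.uinv)) *
        TensorProduct.map (antipode k) (antipode k)
          (TensorProduct.comm k H H (comul (R := k) (Q.a i) * (x ⊗ₜ[k] y))) := by
  have h := Q.sum_comul_comul (LinearMap.mk₂ k
    (fun X Y => TensorProduct.comm k H H Y * (Q.el * (Q.uinv ⊗ₜ[k] Q.uinv)) *
      TensorProduct.map (antipode k) (antipode k)
        (TensorProduct.comm k H H (X * (x ⊗ₜ[k] y))))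
    (by intros; simp [mul_add, add_mul]) (by intros; simp)
    (by intros; simp [add_mul]) (by intros; simp))
  simp only [LinearMap.mk₂_apply] at h
  rw [h, sum_braidedAntipode_tmul, outerTwist_apply]
  refine sum_congr rfl fun p _ => ?_
  simp [RMat.el, mul_sum, sum_mul, antipode_mul_antidistrib, mul_assoc]

theorem comul_braidedAntipode (Q : QT k H) (h : H) :
    comul (R := k) (Q.braidedAntipode h) =
      Q.elOp * Q.outerTwist (∑ t ∈ (ℛ k h).index, ∑ i, ∑ j,
        Q.braidedAntipode (Q.a i * (ℛ k h).right t * Q.a j) ⊗ₜ[k]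
          Q.braidedAntipode ((ℛ k h).left t * (Q.b j * antipode k (Q.b i)))) := by
  rw [map_sum]
  simp only [outerTwist_sum_braidedAntipode_tmul]
  rw [sum_comm]
  simp only [← mul_sum, ← map_sum, (ℛ k h).eq, ← Bialgebra.comul_mul, ← comul_antipode]
  rw [mul_sum]
  simp only [← mul_assoc, elOp_mul_comm_comul]
  simp only [braidedAntipode_apply, map_sum, Bialgebra.comul_mul, comul_uinv, mul_assoc]

theorem sum_conjBil_tmul_conjBil (Q : QT k H) (x y : H) :
    ∑ i, TensorProduct.lift (conjBil k H) (comul (R := k) (Q.b i)) x ⊗ₜ[k]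
        TensorProduct.lift (conjBil k H) (comul (R := k) (Q.a i)) y =
      Q.innerTwist (Q.elOp * Q.outerTwist (x ⊗ₜ[k] y) * Q.elOp) := by
  have h := Q.sum_comul_comul (LinearMap.mk₂ k
    (fun X Y => TensorProduct.lift (conjBil k H) Y x ⊗ₜ[k]
      TensorProduct.lift (conjBil k H) X y)
    (by intros; simp [tmul_add]) (by intros; simp)
    (by intros; simp [add_tmul]) (by intros; simp [smul_tmul']))
  rw [innerTwist_apply]
  refine h.trans (sum_congr rfl fun p _ => ?_)
  change ∑ q, ∑ r, ∑ s, TensorProduct.lift (conjBil k H) ((Q.b q * Q.b s) ⊗ₜ (Q.b p * Q.b r)) x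
    ⊗ₜ[k] TensorProduct.lift (conjBil k H) ((Q.a p * Q.a q) ⊗ₜ (Q.a r * Q.a s)) y = _
  have e (t : H ⊗[k] H) : Q.elOp * t * Q.elOp = ∑ q, ∑ r,
      (Q.b q ⊗ₜ[k] Q.a q) * t * (antipode k (Q.b r) ⊗ₜ[k] antipode k (Q.a r)) := by
    simp only [← mul_sum, ← sum_mul, sum_antipode_tmul_antipode_op]
    rfl
  rw [e, outerTwist_apply]
  simp [conjBil, mul_sum, sum_mul, antipode_mul_antidistrib, mul_assoc]

theorem lmul_apply_eq (Q : QT k H) (φ ψ : Module.Dual k H) (z : H) :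
    Q.lmul φ ψ z = TensorProduct.lift ((LinearMap.mul k k).compl₁₂ φ ψ)
      (Q.innerTwist (comul (R := k) z * Q.elOp)) := by
  simp only [RMat.lmul, LinearMap.sum_apply, conv, LinearMap.comp_apply]
  rw [← (ℛ k z).eq, innerTwist_apply, map_sum]
  refine sum_congr rfl fun i _ => ?_
  simp [RMat.elOp, mul_sum, sum_mul, mul_assoc]

end QT

end Auxiliary

theorem statement19
    {k H : Type*} [Field k] [Ring H] [HopfAlgebra k H] [FiniteDimensional k H]
    (Q : QT k H) (φ ψ : Module.Dual k H) :
    Q.sL (Q.toRMat.lmul φ ψ) =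
      ∑ i, Q.toRMat.lmul (Q.sL (coad (Q.a i) ψ)) (Q.sL (coad (Q.b i) φ)) := by
  ext h
  rw [Q.sL_apply, Q.lmul_apply_eq, Q.comul_braidedAntipode]
  simp only [map_sum, Finset.sum_mul, Finset.mul_sum, ← Q.sum_conjBil_tmul_conjBil]
  simp only [RMat.lmul, LinearMap.sum_apply, conv, LinearMap.comp_apply]
  rw [← (Coalgebra.Repr.arbitrary k h).eq]
  simp only [map_sum, TensorProduct.lift.tmul, LinearMap.compl₁₂_apply, LinearMap.comp_apply,
    LinearMap.mul_apply', LinearMap.mulLeft_apply, LinearMap.mulRight_apply, Q.sL_apply, coad]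
  calc
    _ = ∑ i, ∑ j, ∑ p, ∑ t ∈ (Coalgebra.Repr.arbitrary k h).index, _ :=
      Finset.sum_comm.trans (Finset.sum_congr rfl fun _ _ => Finset.sum_comm.trans
        (Finset.sum_congr rfl fun _ _ => Finset.sum_comm))
    _ = ∑ p, ∑ i, ∑ j, ∑ t ∈ (Coalgebra.Repr.arbitrary k h).index, _ :=
      (Finset.sum_congr rfl fun _ _ => Finset.sum_comm).trans Finset.sum_comm
    _ = _ := by simp only [mul_assoc, mul_comm (φ _)]

end
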